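/- The finiteness problem for multiway systems is undecidable: encoding multiway systems over the alphabet {a, b} as pairs (finite list of rewrite rules, initial string), there is no computable (decidable) predicate that, given such an encoded multiway system M, decides whether M is finite, i.e. whether there exists N such that g_M(n) = 0 for all n ≥ N. -/

import Mathlib

/-- One rewrite step of a multiway system over the alphabet `{a, b}` (modelled as `Bool`),
encoded as a pair `(finite list of rewrite rules, initial string)`. -/
def MWStep (R : List (List Bool × List Bool)) (x y : List Bool) : Prop :=
  ∃ p ∈ R, ∃ u v : List Bool, x = u ++ p.1 ++ v ∧ y = u ++ p.2 ++ v

/-- Reachability in exactly `n` rewrite steps from the initial string. -/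
def MWStepN (R : List (List Bool × List Bool)) (s : List Bool) : ℕ → List Bool → Prop
  | 0 => fun x => x = s
  | n + 1 => fun y => ∃ x, MWStepN R s n x ∧ MWStep R x y

/-- The growth function of an encoded multiway system: the number of strings whose
shortest rewrite distance from the initial string is exactly `n`. -/
noncomputable def mwGrowth (p : List (List Bool × List Bool) × List Bool) (n : ℕ) : ℕ :=
  {x : List Bool | MWStepN p.1 p.2 n x ∧ ∀ k < n, ¬ MWStepN p.1 p.2 k x}.ncard

open Relation

namespace Multiway

section Growth

variable {R : List (List Bool × List Bool)} {s : List Bool}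

theorem exists_mwStepN_iff {x : List Bool} :
    (∃ n, MWStepN R s n x) ↔ ReflTransGen (MWStep R) s x := by
  constructor
  · rintro ⟨n, h⟩
    induction n generalizing x with
    | zero => exact h ▸ .refl
    | succ n ih =>
      obtain ⟨y, hy, hyx⟩ := h
      exact (ih hy).tail hyx
  · intro h
    induction h with
    | refl => exact ⟨0, rfl⟩
    | tail _ hbc ih =>
      obtain ⟨n, hn⟩ := ih
      exact ⟨n + 1, _, hn, hbc⟩

theorem finite_setOf_mwStep (x : List Bool) : {y | MWStep R x y}.Finite := by
  have hx : {uv : List Bool × List Bool | uv.1.length ≤ x.length ∧ uv.2.length ≤ x.length}.Finite :=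
    (List.finite_length_le Bool x.length).prod (List.finite_length_le Bool x.length)
  refine ((R.finite_toSet.prod hx).image fun q => q.2.1 ++ q.1.2 ++ q.2.2).subset ?_
  rintro y ⟨p, hp, u, v, rfl, rfl⟩
  exact ⟨(p, u, v), ⟨hp, by simp; omega⟩, rfl⟩

theorem finite_setOf_mwStepN (n : ℕ) : {x | MWStepN R s n x}.Finite := by
  induction n with
  | zero => exact Set.finite_singleton s
  | succ n ih =>
    refine (ih.biUnion fun x _ => finite_setOf_mwStep (R := R) x).subset ?_
    rintro y ⟨x, hx, hxy⟩
    exact Set.mem_biUnion (show x ∈ {x | MWStepN R s n x} from hx) hxy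

theorem mwGrowth_eq_zero_iff {n : ℕ} :
    mwGrowth (R, s) n = 0 ↔ ∀ x, MWStepN R s n x → ∃ k < n, MWStepN R s k x := by
  have hfin : {x : List Bool | MWStepN R s n x ∧ ∀ k < n, ¬ MWStepN R s k x}.Finite :=
    (finite_setOf_mwStepN n).subset fun _ h => h.1
  rw [mwGrowth, Set.ncard_eq_zero hfin, Set.eq_empty_iff_forall_notMem]
  simp

/-- A multiway system is finite if and only if only finitely many strings are reachable. -/
theorem exists_mwGrowth_eq_zero_iff :
    (∃ N, ∀ n, N ≤ n → mwGrowth (R, s) n = 0) ↔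
      {x | ReflTransGen (MWStep R) s x}.Finite := by
  classical
  simp_rw [mwGrowth_eq_zero_iff]
  constructor
  · rintro ⟨N, hN⟩
    refine ((Set.finite_lt_nat N).biUnion fun n _ =>
      finite_setOf_mwStepN (R := R) (s := s) n).subset ?_
    intro x hx
    have hx' := exists_mwStepN_iff.2 hx
    refine Set.mem_biUnion (x := Nat.find hx') ?_ (Nat.find_spec hx')
    by_contra hlt
    obtain ⟨k, hk, hkx⟩ := hN _ (not_lt.1 hlt) x (Nat.find_spec hx')
    exact Nat.find_min hx' hk hkx
  · intro hfin
    have hex : ∀ x, ∃ n, ReflTransGen (MWStep R) s x → MWStepN R s n x := fun x => by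
      by_cases hx : ReflTransGen (MWStep R) s x
      · obtain ⟨n, hn⟩ := exists_mwStepN_iff.2 hx
        exact ⟨n, fun _ => hn⟩
      · exact ⟨0, fun h => absurd h hx⟩
    choose f hf using hex
    obtain ⟨N, hN⟩ := (hfin.image f).bddAbove
    refine ⟨N + 1, fun n hn x hx => ?_⟩
    have hr := exists_mwStepN_iff.1 ⟨n, hx⟩
    exact ⟨f x, (Nat.lt_of_succ_le (Nat.succ_le_succ (hN ⟨x, hr, rfl⟩))).trans_le hn, hf x hr⟩

end Growth

/-- One step of string rewriting over an arbitrary alphabet, for a set `P` of rules. -/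
def Rewrites {A : Type*} (P : Set (List A × List A)) (x y : List A) : Prop :=
  ∃ p ∈ P, ∃ u v, x = u ++ p.1 ++ v ∧ y = u ++ p.2 ++ v

section Encoding

variable {A : Type*} (φ : A → ℕ)

/-- The block of bits that encodes a letter. -/
def letterBits (a : A) : List Bool :=
  true :: false :: (List.replicate (φ a) false ++ [true])

/-- The letterwise encoding of words over an arbitrary alphabet as bit strings. -/
def wordBits (w : List A) : List Bool :=
  w.flatMap (letterBits φ)

@[simp] theorem wordBits_nil : wordBits φ [] = [] := rfl

@[simp] theorem wordBits_cons (a : A) (w : List A) :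
    wordBits φ (a :: w) = letterBits φ a ++ wordBits φ w := rfl

@[simp] theorem wordBits_append (w w' : List A) :
    wordBits φ (w ++ w') = wordBits φ w ++ wordBits φ w' := by
  simp [wordBits]

theorem replicate_false_append_true_inj {m n : ℕ} {x y : List Bool}
    (h : List.replicate m false ++ true :: x = List.replicate n false ++ true :: y) :
    m = n ∧ x = y := by
  induction m generalizing n with
  | zero => cases n <;> simp_all [List.replicate_succ]
  | succ m ih =>
    cases n with
    | zero => simp [List.replicate_succ] at h
    | succ n =>
      simp only [List.replicate_succ, List.cons_append, List.cons.injEq, true_and] at h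
      exact ⟨congrArg _ (ih h).1, (ih h).2⟩

theorem replicate_false_append_true_split {m : ℕ} {u v : List Bool}
    (h : List.replicate m false ++ [true] = u ++ true :: v) : v = [] := by
  induction m generalizing u with
  | zero =>
    cases u <;> simp_all
  | succ m ih =>
    cases u with
    | nil => simp [List.replicate_succ] at h
    | cons b u =>
      simp only [List.replicate_succ, List.cons_append, List.cons.injEq] at h
      exact ih h.2

variable {φ}

theorem wordBits_eq_append (hφ : φ.Injective) {w r : List A} {v : List Bool}
    (h : wordBits φ w = wordBits φ r ++ v) : ∃ v', w = r ++ v' ∧ v = wordBits φ v' := by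
  induction r generalizing w with
  | nil => exact ⟨w, rfl, h.symm⟩
  | cons a r ih =>
    cases w with
    | nil => simp [letterBits] at h
    | cons b w =>
      simp only [wordBits_cons, letterBits, List.cons_append, List.append_assoc, List.nil_append,
        List.cons.injEq, true_and] at h
      obtain ⟨hab, h⟩ := replicate_false_append_true_inj h
      obtain ⟨v', rfl, rfl⟩ := ih h
      exact ⟨v', by rw [hφ hab]; rfl, rfl⟩

theorem wordBits_injective (hφ : φ.Injective) : (wordBits φ).Injective := by
  intro w r h
  obtain ⟨v', rfl, hv⟩ := wordBits_eq_append (r := r) (v := []) hφ (h.trans (by simp))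
  cases v' with
  | nil => simp
  | cons => simp [letterBits] at hv

theorem wordBits_eq_append_append (hφ : φ.Injective) {w r : List A} {u v : List Bool}
    (hr : r ≠ []) (h : wordBits φ w = u ++ wordBits φ r ++ v) :
    ∃ u' v', w = u' ++ r ++ v' ∧ u = wordBits φ u' ∧ v = wordBits φ v' := by
  induction w generalizing u with
  | nil =>
    obtain ⟨a, r, rfl⟩ := List.exists_cons_of_ne_nil hr
    simp [letterBits] at h
  | cons b w ih =>
    cases u with
    | nil =>
      obtain ⟨v', hv', rfl⟩ := wordBits_eq_append hφ h
      exact ⟨[], v', by simpa using hv', rfl, rfl⟩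
    | cons c u =>
      have key : ∃ u₁, c :: u = letterBits φ b ++ u₁ := by
        rw [wordBits_cons, List.append_assoc, List.append_eq_append_iff] at h
        obtain ⟨u₁, h₁, -⟩ | ⟨d, h₁, h₂⟩ := h
        · exact ⟨u₁, h₁⟩
        · cases d with
          | nil => exact ⟨[], by simpa using h₁.symm⟩
          | cons e d =>
            obtain ⟨a, r, rfl⟩ := List.exists_cons_of_ne_nil hr
            simp only [wordBits_cons, letterBits, List.cons_append, List.cons.injEq] at h₁ h₂
            obtain ⟨rfl, h₂⟩ := h₂
            have hd : d = [] := by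
              refine replicate_false_append_true_split (m := φ b + 1) (u := u) ?_
              simpa [List.replicate_succ] using h₁.2
            subst hd
            cases w <;> simp [letterBits] at h₂
      obtain ⟨u₁, hu₁⟩ := key
      rw [hu₁, wordBits_cons, List.append_assoc, List.append_assoc, List.append_cancel_left_eq,
        ← List.append_assoc] at h
      obtain ⟨u', v', rfl, rfl, rfl⟩ := ih h
      exact ⟨b :: u', v', rfl, hu₁, rfl⟩

/-- Encoding the letters as bits does not change whether finitely many words are reachable. -/
theorem finite_reachable_wordBits_iff (hφ : φ.Injective) {P : Set (List A × List A)}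
    (hP : ∀ p ∈ P, p.1 ≠ []) {R : List (List Bool × List Bool)}
    (hR : ∀ q, q ∈ R ↔ ∃ p ∈ P, (wordBits φ p.1, wordBits φ p.2) = q) (s : List A) :
    {x | ReflTransGen (MWStep R) (wordBits φ s) x}.Finite ↔
      {w | ReflTransGen (Rewrites P) s w}.Finite := by
  have himage : {x | ReflTransGen (MWStep R) (wordBits φ s) x} =
      wordBits φ '' {w | ReflTransGen (Rewrites P) s w} := by
    ext x
    constructor
    · intro h
      induction h with
      | refl => exact ⟨s, .refl, rfl⟩
      | tail _ hbc ih =>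
        obtain ⟨w, hw, rfl⟩ := ih
        obtain ⟨q, hq, u, v, hu, rfl⟩ := hbc
        obtain ⟨p, hp, rfl⟩ := (hR q).1 hq
        obtain ⟨u', v', rfl, rfl, rfl⟩ := wordBits_eq_append_append hφ (hP p hp) hu
        exact ⟨u' ++ p.2 ++ v', hw.tail ⟨p, hp, u', v', rfl, rfl⟩, by simp⟩
    · rintro ⟨w, hw, rfl⟩
      refine hw.lift (wordBits φ) ?_
      rintro _ _ ⟨p, hp, u, v, rfl, rfl⟩
      exact ⟨_, (hR _).2 ⟨p, hp, rfl⟩, wordBits φ u, wordBits φ v, by simp, by simp⟩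
  rw [himage, Set.finite_image_iff (wordBits_injective hφ).injOn]

end Encoding

section StackMachine

open StateTransition

variable {Q K Γ : Type*}

/-- Letters other than the control state: `none` is a tally mark, `some (k, some a)` is the symbol
`a` on stack `k`, and `some (k, none)` marks the bottom of stack `k`. -/
abbrev StackLetter (K Γ : Type*) : Type _ := Option (K × Option Γ)

/-- The word representing the content of stack `k`. -/
def stackWord (k : K) (s : List Γ) : List (StackLetter K Γ) :=
  s.map (fun a => some (k, some a)) ++ [some (k, none)]

/-- A stack machine is given by its transition function: in state `q` it halts if `δ q = none`, and
if `δ q = some (k, g)` it pops the top symbol `o` of stack `k`, if there is one, moves to the state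
`(g o).1` and pushes the word `(g o).2`. -/
abbrev StackMachine (Q K Γ : Type*) : Type _ := Q → Option (K × (Option Γ → Q × List Γ))

/-- The effect of a single operation of a stack machine. -/
def StackMachine.apply [DecidableEq K] (kg : K × (Option Γ → Q × List Γ)) (S : K → List Γ) :
    Q × (K → List Γ) :=
  ((kg.2 (S kg.1).head?).1,
    Function.update S kg.1 ((kg.2 (S kg.1).head?).2 ++ (S kg.1).tail))

/-- The step function of a stack machine. -/
def StackMachine.step [DecidableEq K] (δ : StackMachine Q K Γ) (c : Q × (K → List Γ)) :
    Option (Q × (K → List Γ)) :=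
  (δ c.1).map fun kg => apply kg c.2

/-- The word replacing the top letter `some (k, o)` of stack `k` when `w` is pushed. -/
def pushWord (k : K) (o : Option Γ) (w : List Γ) : List (StackLetter K Γ) :=
  w.map (fun a => some (k, some a)) ++ if o.isNone then [some (k, none)] else []

/-- The rewrite rules simulating a stack machine. Letters of distinct stacks commute, the control
state acts on the letter to its right, and each operation leaves a tally mark. -/
def StackMachine.rules (δ : StackMachine Q K Γ) :
    Set (List (Q ⊕ StackLetter K Γ) × List (Q ⊕ StackLetter K Γ)) :=
  {p | ∃ x y : StackLetter K Γ, x.map Prod.fst ≠ y.map Prod.fst ∧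
    p = ([.inr x, .inr y], [.inr y, .inr x])} ∪
  {p | ∃ q k g o, δ q = some (k, g) ∧ p = ([.inl q, .inr (some (k, o))],
    .inl (g o).1 :: (none :: pushWord k o (g o).2).map .inr)}

theorem StackMachine.rules_ne_nil (δ : StackMachine Q K Γ) : ∀ p ∈ δ.rules, p.1 ≠ [] := by
  rintro p (⟨x, y, -, rfl⟩ | ⟨q, k, g, o, -, rfl⟩) <;> simp

theorem StackMachine.finite_rules [Finite Q] [Finite K] [Finite Γ] (δ : StackMachine Q K Γ) :
    δ.rules.Finite := by
  refine Set.Finite.union ?_ ?_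
  · refine (Set.finite_range fun xy : StackLetter K Γ × StackLetter K Γ =>
      (([.inr xy.1, .inr xy.2], [.inr xy.2, .inr xy.1]) :
        List (Q ⊕ StackLetter K Γ) × List (Q ⊕ StackLetter K Γ))).subset ?_
    rintro p ⟨x, y, -, rfl⟩
    exact ⟨(x, y), rfl⟩
  · have hδ (q : Q) : {kg | δ q = some kg}.Finite := by
      cases h : δ q with
      | none => simp
      | some kg => simp
    refine (Set.finite_iUnion fun q => ((hδ q).prod (Set.finite_univ (α := Option Γ))).image
      fun kgo : (K × (Option Γ → Q × List Γ)) × Option Γ =>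
        (([.inl q, .inr (some (kgo.1.1, kgo.2))], .inl (kgo.1.2 kgo.2).1 ::
          (none :: pushWord kgo.1.1 kgo.2 (kgo.1.2 kgo.2).2).map .inr) :
            List (Q ⊕ StackLetter K Γ) × List (Q ⊕ StackLetter K Γ))).subset ?_
    rintro p ⟨q, k, g, o, h, rfl⟩
    exact Set.mem_iUnion.2 ⟨q, ((k, g), o), ⟨h, trivial⟩, rfl⟩

/-- The tally marks of `l`. -/
def tallyPart (l : List (StackLetter K Γ)) : List (StackLetter K Γ) :=
  l.filter fun x => x.map Prod.fst = none

@[simp] theorem tallyPart_append (l l' : List (StackLetter K Γ)) :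
    tallyPart (l ++ l') = tallyPart l ++ tallyPart l' := List.filter_append ..

theorem tallyPart_pushWord (k : K) (o : Option Γ) (w : List Γ) :
    tallyPart (pushWord k o w) = [] := by
  refine List.filter_eq_nil_iff.2 fun x hx => ?_
  simp only [pushWord, List.mem_append, List.mem_map] at hx
  obtain ⟨a, -, rfl⟩ | hx := hx
  · simp
  · split_ifs at hx <;> simp_all

theorem tallyPart_swap {x y : StackLetter K Γ} (h : x.map Prod.fst ≠ y.map Prod.fst) :
    tallyPart [x, y] = tallyPart [y, x] := by
  simp only [tallyPart, List.filter_cons, List.filter_nil]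
  by_cases hx : x.map Prod.fst = none <;> by_cases hy : y.map Prod.fst = none <;> simp_all

theorem head_of_cons_eq_stackWord {k : K} {o : Option Γ} {r : List (StackLetter K Γ)} {s : List Γ}
    (h : some (k, o) :: r = stackWord k s) (w : List Γ) :
    s.head? = o ∧ pushWord k o w ++ r = stackWord k (w ++ s.tail) := by
  cases s with
  | nil =>
    simp only [stackWord, List.map_nil, List.nil_append, List.cons.injEq, Option.some.injEq,
      Prod.mk.injEq, true_and] at h
    obtain ⟨rfl, rfl⟩ := h
    simp [pushWord, stackWord]
  | cons a s =>
    simp only [stackWord, List.map_cons, List.cons_append, List.cons.injEq, Option.some.injEq,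
      Prod.mk.injEq, true_and] at h
    obtain ⟨rfl, rfl⟩ := h
    simp [pushWord, stackWord]

theorem reachable_move_front (δ : StackMachine Q K Γ) {x : StackLetter K Γ}
    {l₁ : List (StackLetter K Γ)} (h : ∀ y ∈ l₁, y.map Prod.fst ≠ x.map Prod.fst)
    (a b : List (Q ⊕ StackLetter K Γ)) :
    ReflTransGen (Rewrites δ.rules) (a ++ (l₁ ++ [x]).map .inr ++ b)
      (a ++ (x :: l₁).map .inr ++ b) := by
  induction l₁ generalizing a with
  | nil => exact .refl
  | cons y l₁ ih =>
    have h₁ := ih (fun z hz => h z (List.mem_cons_of_mem _ hz)) (a ++ [.inr y])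
    simp only [List.map_cons, List.map_append, List.append_assoc, List.cons_append,
      List.nil_append, List.map_nil] at h₁ ⊢
    refine h₁.tail ⟨_, .inl ⟨y, x, h y (by simp), rfl⟩, a, l₁.map .inr ++ b, by simp, by simp⟩

variable [DecidableEq K]

/-- The letters of `l` that belong to stack `k`. -/
def stackPart (k : K) (l : List (StackLetter K Γ)) : List (StackLetter K Γ) :=
  l.filter fun x => x.map Prod.fst = some k

/-- The word `w` represents the configuration `c` after `t` operations. -/
def Represents (c : Q × (K → List Γ)) (t : ℕ) (w : List (Q ⊕ StackLetter K Γ)) : Prop :=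
  ∃ l : List (StackLetter K Γ), w = .inl c.1 :: l.map .inr ∧
    (∀ k, stackPart k l = stackWord k (c.2 k)) ∧ (tallyPart l).length = t

@[simp] theorem stackPart_append (k : K) (l l' : List (StackLetter K Γ)) :
    stackPart k (l ++ l') = stackPart k l ++ stackPart k l' := List.filter_append ..

theorem stackPart_pushWord (j k : K) (o : Option Γ) (w : List Γ) :
    stackPart j (pushWord k o w) = if j = k then pushWord k o w else [] := by
  split_ifs with h
  · subst h
    refine List.filter_eq_self.2 fun x hx => ?_
    simp only [pushWord, List.mem_append, List.mem_map] at hx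
    obtain ⟨a, -, rfl⟩ | hx := hx
    · simp
    · split_ifs at hx <;> simp_all
  · refine List.filter_eq_nil_iff.2 fun x hx => ?_
    simp only [pushWord, List.mem_append, List.mem_map] at hx
    obtain ⟨a, -, rfl⟩ | hx := hx
    · simpa using Ne.symm h
    · have hkj : k ≠ j := Ne.symm h
      split_ifs at hx <;> simp_all

theorem stackPart_swap (k : K) {x y : StackLetter K Γ} (h : x.map Prod.fst ≠ y.map Prod.fst) :
    stackPart k [x, y] = stackPart k [y, x] := by
  simp only [stackPart, List.filter_cons, List.filter_nil]
  by_cases hx : x.map Prod.fst = some k <;> by_cases hy : y.map Prod.fst = some k <;> simp_all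

theorem Represents.of_operation {δ : StackMachine Q K Γ} {q : Q} {S : K → List Γ} {t : ℕ} {k : K}
    {g : Option Γ → Q × List Γ} {o : Option Γ} {l : List (StackLetter K Γ)}
    (hδ : δ q = some (k, g))
    (h : Represents (q, S) t (.inl q :: (some (k, o) :: l).map .inr)) :
    ∃ c', δ.step (q, S) = some c' ∧ Represents c' (t + 1)
      (.inl (g o).1 :: ((none :: pushWord k o (g o).2) ++ l).map .inr) := by
  obtain ⟨l', hl', hS, ht⟩ := h
  have hl : some (k, o) :: l = l' := by
    rw [List.cons.injEq] at hl'
    exact List.map_injective_iff.2 Sum.inr_injective hl'.2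
  subst hl
  have hk : some (k, o) :: stackPart k l = stackWord k (S k) := by
    rw [← hS k]; simp [stackPart]
  obtain ⟨ho, hw⟩ := head_of_cons_eq_stackWord hk (g o).2
  refine ⟨StackMachine.apply (k, g) S, by simp [StackMachine.step, hδ],
    (none :: pushWord k o (g o).2) ++ l, ?_, fun j => ?_, ?_⟩
  · simp [StackMachine.apply, ho]
  · have hnone : stackPart j (none :: pushWord k o (g o).2) = stackPart j (pushWord k o (g o).2) := by
      simp [stackPart]
    rw [stackPart_append, hnone, stackPart_pushWord]
    simp only [StackMachine.apply, ho]
    split_ifs with hj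
    · subst hj
      rw [hw]; simp
    · rw [Function.update_of_ne hj, ← hS j]
      simp [stackPart, Ne.symm hj]
  · have hnone : tallyPart (none :: pushWord k o (g o).2) = [none] := by
      have := tallyPart_pushWord k o (g o).2
      simp_all [tallyPart]
    rw [tallyPart_append, hnone, ← ht]
    simp [tallyPart, add_comm]

/-- Soundness of the simulation. -/
theorem Represents.of_rewrites {δ : StackMachine Q K Γ} {c : Q × (K → List Γ)} {t : ℕ}
    {w w' : List (Q ⊕ StackLetter K Γ)} (h : Represents c t w) (hw : Rewrites δ.rules w w') :
    Represents c t w' ∨ ∃ c', δ.step c = some c' ∧ Represents c' (t + 1) w' := by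
  obtain ⟨p, hp, u, v, hu, rfl⟩ := hw
  have h' := h
  obtain ⟨l, rfl, hS, ht⟩ := h
  obtain ⟨x, y, hxy, rfl⟩ | ⟨q, k, g, o, hδ, rfl⟩ := hp
  · left
    cases u with
    | nil => simp at hu
    | cons a u =>
      simp only [List.cons_append, List.cons.injEq] at hu
      obtain ⟨rfl, hu⟩ := hu
      obtain ⟨l₁, l₂, rfl, h₁, h₂⟩ := List.map_eq_append_iff.1 hu
      obtain ⟨l₀, l₁', rfl, rfl, h₁'⟩ := List.map_eq_append_iff.1 h₁
      have hl₁ : l₁' = [x, y] :=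
        List.map_injective_iff.2 Sum.inr_injective (h₁'.trans (by simp))
      subst hl₁
      subst h₂
      refine ⟨l₀ ++ [y, x] ++ l₂, by simp, fun k => ?_, ?_⟩
      · rw [← hS k]; simp only [stackPart_append, stackPart_swap k hxy]
      · rw [← ht]; simp only [tallyPart_append, tallyPart_swap hxy]
  · right
    cases u with
    | cons a u =>
      simp only [List.cons_append, List.cons.injEq] at hu
      have : Sum.inl q ∈ l.map (Sum.inr : _ → Q ⊕ StackLetter K Γ) := by
        rw [hu.2]; simp
      simp at this
    | nil =>
      simp only [List.nil_append, List.cons_append, List.cons.injEq, Sum.inl.injEq] at hu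
      obtain ⟨rfl, hu⟩ := hu
      obtain ⟨x, l', rfl, hx, rfl⟩ := List.map_eq_cons_iff.1 hu
      rw [Sum.inr.injEq] at hx
      subst hx
      obtain ⟨c', hc', hr⟩ := Represents.of_operation hδ h'
      exact ⟨c', hc', by simpa using hr⟩

/-- Completeness of the simulation. -/
theorem Represents.exists_of_step {δ : StackMachine Q K Γ} {c c' : Q × (K → List Γ)} {t : ℕ}
    {w : List (Q ⊕ StackLetter K Γ)} (h : Represents c t w) (hc : δ.step c = some c') :
    ∃ w', ReflTransGen (Rewrites δ.rules) w w' ∧ Represents c' (t + 1) w' := by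
  obtain ⟨l, rfl, hS, ht⟩ := h
  obtain ⟨⟨k, g⟩, hδ, -⟩ := Option.map_eq_some_iff.1 hc
  have hne : ∃ x r, stackPart k l = x :: r := by
    refine List.exists_cons_of_ne_nil ?_
    simp [hS k, stackWord]
  obtain ⟨x, r, hx⟩ := hne
  obtain ⟨l₁, l₂, rfl, h₁, hxk, hr⟩ := List.filter_eq_cons_iff.1 hx
  obtain ⟨⟨k', o⟩, rfl, rfl⟩ : ∃ ko : K × Option Γ, x = some ko ∧ ko.1 = k := by
    simpa [Option.map_eq_some_iff] using hxk
  have hmove := reachable_move_front δ (x := some (k', o)) (l₁ := l₁)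
    (fun y hy => by simpa using h₁ y hy) [.inl c.1] (l₂.map .inr)
  have hrep : Represents c t (.inl c.1 :: (some (k', o) :: (l₁ ++ l₂)).map .inr) := by
    have hnil : stackPart k' l₁ = [] := List.filter_eq_nil_iff.2 h₁
    refine ⟨_, rfl, fun j => ?_, ?_⟩
    · rw [← hS j]
      by_cases hj : k' = j
      · subst hj
        simp only [stackPart] at hnil ⊢
        simp [hnil]
      · simp [stackPart, hj]
    · rw [← ht]
      simp [tallyPart]
  obtain ⟨c₁, hc₁, hrep'⟩ := Represents.of_operation hδ hrep
  rw [Prod.mk.eta, hc, Option.some.injEq] at hc₁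
  subst hc₁
  refine ⟨_, (ReflTransGen.tail (by simpa using hmove) ?_), hrep'⟩
  exact ⟨_, .inr ⟨c.1, k', g, o, hδ, rfl⟩, [], (l₁ ++ l₂).map .inr, by simp, by simp⟩

theorem finite_setOf_represents (c : Q × (K → List Γ)) (t : ℕ) :
    {w | Represents c t w}.Finite := by
  classical
  obtain hempty | ⟨w₀, l₀, -, hS, ht⟩ := Set.eq_empty_or_nonempty {w | Represents c t w}
  · rw [hempty]; exact Set.finite_empty
  refine ((l₀.permutations.finite_toSet).image fun l => .inl c.1 :: l.map .inr).subset ?_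
  rintro _ ⟨l, rfl, hS', ht'⟩
  refine ⟨l, List.mem_permutations.2 (List.perm_iff_count.2 fun x => ?_), rfl⟩
  cases x with
  | none =>
    have hcount (l : List (StackLetter K Γ)) : l.count none = (tallyPart l).length := by
      rw [List.count, List.countP_eq_length_filter, tallyPart]
      congr 2
      ext x
      cases x <;> simp
    rw [hcount, hcount, ht, ht']
  | some ko =>
    have hcount (l : List (StackLetter K Γ)) :
        l.count (some ko) = (stackPart ko.1 l).count (some ko) := by
      rw [stackPart, List.count_filter]; simp
    rw [hcount l, hcount l₀, hS, hS']

/-- The reachable set of the simulation is finite exactly when the stack machine halts. -/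
theorem finite_reachable_rules_iff (δ : StackMachine Q K Γ) {c : Q × (K → List Γ)} {t : ℕ}
    {w : List (Q ⊕ StackLetter K Γ)} (h : Represents c t w) :
    {w' | ReflTransGen (Rewrites δ.rules) w w'}.Finite ↔ (eval δ.step c).Dom := by
  classical
  constructor
  · intro hfin
    by_contra hdom
    have key (n : ℕ) : ∃ c' w', ReflTransGen (Rewrites δ.rules) w w' ∧
        Represents c' (t + n) w' ∧ ¬ (eval δ.step c').Dom := by
      induction n with
      | zero => exact ⟨c, w, .refl, h, hdom⟩
      | succ n ih =>
        obtain ⟨c', w', hw', hrep, hd⟩ := ih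
        cases hc : δ.step c' with
        | none => exact absurd (Part.dom_iff_mem.2 ⟨c', mem_eval.2 ⟨.refl, hc⟩⟩) hd
        | some c'' =>
          obtain ⟨w'', hw'', hrep'⟩ := hrep.exists_of_step hc
          refine ⟨c'', w'', hw'.trans hw'', hrep', ?_⟩
          rwa [← reaches_eval (a := c') (.single hc)]
    obtain ⟨N, hN⟩ := (hfin.image List.length).bddAbove
    obtain ⟨c', w', hw', ⟨l, rfl, -, ht⟩, -⟩ := key (N + 1)
    have h₁ := hN ⟨_, hw', rfl⟩
    have h₂ : (tallyPart l).length ≤ l.length := List.length_filter_le ..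
    simp at h₁
    omega
  · intro hdom
    obtain ⟨b, hb⟩ := Part.dom_iff_mem.1 hdom
    obtain ⟨hreach, hnone⟩ := mem_eval.1 hb
    have key : ∀ t, ∃ F : Set (List (Q ⊕ StackLetter K Γ)), F.Finite ∧
        {w | Represents c t w} ⊆ F ∧ ∀ x ∈ F, ∀ y, Rewrites δ.rules x y → y ∈ F := by
      clear h hdom hb
      induction hreach using ReflTransGen.head_induction_on with
      | refl =>
        refine fun t => ⟨_, finite_setOf_represents b t, subset_rfl, fun x hx y hxy => ?_⟩
        obtain hy | ⟨c', hc', -⟩ := Represents.of_rewrites hx hxy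
        · exact hy
        · rw [hnone] at hc'; cases hc'
      | head hac _ ih =>
        intro t
        obtain ⟨F, hF, hsub, hcl⟩ := ih (t + 1)
        refine ⟨_, (finite_setOf_represents _ t).union hF, Set.subset_union_left, ?_⟩
        rintro x (hx | hx) y hxy
        · obtain hy | ⟨c', hc', hy⟩ := Represents.of_rewrites hx hxy
          · exact .inl hy
          · rw [Option.mem_def.1 hac, Option.some.injEq] at hc'
            exact .inr (hsub (hc' ▸ hy))
        · exact .inr (hcl x hx y hxy)
    obtain ⟨F, hF, hsub, hcl⟩ := key t
    refine hF.subset fun x hx => ?_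
    induction hx with
    | refl => exact hsub h
    | tail _ hbc ih => exact hcl _ ih _ hbc

end StackMachine

section Restrict

open StateTransition

variable {Q K Γ : Type*} [DecidableEq K]

open Classical in
/-- The restriction of a stack machine to a set of control states. -/
noncomputable def StackMachine.restrict (δ : StackMachine Q K Γ) (S : Finset Q) :
    StackMachine S K Γ := fun q =>
  (δ q).map fun kg =>
    (kg.1, fun o => (if h : (kg.2 o).1 ∈ S then ⟨(kg.2 o).1, h⟩ else q, (kg.2 o).2))

theorem StackMachine.eval_restrict_dom {δ : StackMachine Q K Γ} {S : Finset Q}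
    (hS : ∀ q ∈ S, ∀ kg, δ q = some kg → ∀ o, (kg.2 o).1 ∈ S) (c : S × (K → List Γ)) :
    (eval (δ.restrict S).step c).Dom ↔ (eval δ.step (c.1.1, c.2)).Dom := by
  have hresp : Respects (δ.restrict S).step δ.step fun c c' => (c.1.1, c.2) = c' := by
    refine fun_respects.2 fun c => ?_
    cases h : δ c.1 with
    | none => simp [StackMachine.step, StackMachine.restrict, h, FRespects]
    | some kg =>
      have hstep : (δ.restrict S).step c =
          some (StackMachine.apply (kg.1, fun o => (⟨(kg.2 o).1, hS _ c.1.2 _ h o⟩, (kg.2 o).2))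
            c.2) := by
        simp [StackMachine.step, StackMachine.restrict, h, hS _ c.1.2 _ h]
      rw [hstep]
      refine Relation.TransGen.single ?_
      simp [StackMachine.step, StackMachine.apply, h]
  exact (tr_eval_dom hresp rfl).symm

end Restrict

section TM2

open StateTransition Turing Turing.TM2

variable {K Γ Λ σ : Type*}

/-- The stack machine that runs a program in Mathlib's `TM2` model one statement at a time. -/
def ofTM2 [Inhabited K] (M : Λ → Stmt (fun _ : K => Γ) Λ σ) :
    StackMachine (Option (Stmt (fun _ : K => Γ) Λ σ) × σ) K Γ
  | (none, _) => none
  | (some (.push k f q), v) => some (k, fun o => ((some q, v), f v :: o.toList))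
  | (some (.peek k f q), v) => some (k, fun o => ((some q, f v o), o.toList))
  | (some (.pop k f q), v) => some (k, fun o => ((some q, f v o), []))
  | (some (.load a q), v) => some (default, fun o => ((some q, a v), o.toList))
  | (some (.branch f q₁ q₂), v) =>
    some (default, fun o => ((some (cond (f v) q₁ q₂), v), o.toList))
  | (some (.goto f), v) => some (default, fun o => ((some (M (f v)), v), o.toList))
  | (some .halt, v) => some (default, fun o => ((none, v), o.toList))

/-- The configuration of `ofTM2 M` that corresponds to a configuration of `M`. -/
def ofTM2Cfg (M : Λ → Stmt (fun _ : K => Γ) Λ σ) (c : Cfg (fun _ : K => Γ) Λ σ) :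
    (Option (Stmt (fun _ : K => Γ) Λ σ) × σ) × (K → List Γ) :=
  ((c.l.map M, c.var), c.stk)

theorem toList_head?_append_tail (l : List Γ) : l.head?.toList ++ l.tail = l := by
  cases l <;> rfl

theorem reaches₁_stepAux [Inhabited K] [DecidableEq K] (M : Λ → Stmt (fun _ : K => Γ) Λ σ)
    (q : Stmt (fun _ : K => Γ) Λ σ) (v : σ) (S : K → List Γ) :
    Reaches₁ (ofTM2 M).step ((some q, v), S) (ofTM2Cfg M (stepAux q v S)) := by
  induction q generalizing v S with
  | goto f =>
    refine .single ?_
    simp [StackMachine.step, StackMachine.apply, ofTM2, ofTM2Cfg, toList_head?_append_tail]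
  | halt =>
    refine .single ?_
    simp [StackMachine.step, StackMachine.apply, ofTM2, ofTM2Cfg, toList_head?_append_tail]
  | branch f q₁ q₂ ih₁ ih₂ =>
    cases h : f v
    · rw [stepAux, h]
      refine .head ?_ (ih₂ v S)
      simp [StackMachine.step, StackMachine.apply, ofTM2, h, toList_head?_append_tail]
    · rw [stepAux, h]
      refine .head ?_ (ih₁ v S)
      simp [StackMachine.step, StackMachine.apply, ofTM2, h, toList_head?_append_tail]
  | load a q ih =>
    refine .head ?_ (ih _ _)
    simp [StackMachine.step, StackMachine.apply, ofTM2, toList_head?_append_tail]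
  | push k f q ih =>
    refine .head ?_ (ih _ _)
    simp [StackMachine.step, StackMachine.apply, ofTM2, toList_head?_append_tail]
  | peek k f q ih =>
    refine .head ?_ (ih _ _)
    simp [StackMachine.step, StackMachine.apply, ofTM2, toList_head?_append_tail]
  | pop k f q ih =>
    refine .head ?_ (ih _ _)
    simp [StackMachine.step, StackMachine.apply, ofTM2]

theorem eval_ofTM2_dom [Inhabited K] [DecidableEq K] (M : Λ → Stmt (fun _ : K => Γ) Λ σ)
    (c : Cfg (fun _ : K => Γ) Λ σ) :
    (eval (ofTM2 M).step (ofTM2Cfg M c)).Dom ↔ (eval (TM2.step M) c).Dom := by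
  have hresp : Respects (TM2.step M) (ofTM2 M).step fun c c' => ofTM2Cfg M c = c' := by
    refine fun_respects.2 fun c => ?_
    obtain ⟨l, v, S⟩ := c
    cases l with
    | none => simp [FRespects, StackMachine.step, ofTM2Cfg, ofTM2]
    | some l => exact reaches₁_stepAux M (M l) v S
  exact tr_eval_dom hresp rfl

/-- The control states of `ofTM2 M` that occur when the labels of `M` are confined to `S`. -/
noncomputable def ofTM2Support [Fintype σ] (M : Λ → Stmt (fun _ : K => Γ) Λ σ) (S : Finset Λ) :
    Finset (Option (Stmt (fun _ : K => Γ) Λ σ) × σ) :=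
  stmts M S ×ˢ Finset.univ

theorem mem_ofTM2Support_of_mem [Fintype σ] {M : Λ → Stmt (fun _ : K => Γ) Λ σ} {S : Finset Λ}
    {l : Λ} (hl : l ∈ S) (v : σ) : (some (M l), v) ∈ ofTM2Support M S := by
  simp only [ofTM2Support, Finset.mem_product, Finset.mem_univ, and_true, stmts,
    Finset.some_mem_insertNone, Finset.mem_biUnion]
  exact ⟨l, hl, stmts₁_self⟩

theorem ofTM2Support_closed [Inhabited K] [Fintype σ] [Inhabited Λ] {M : Λ → Stmt (fun _ : K => Γ) Λ σ}
    {S : Finset Λ} (hS : Supports M S) :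
    ∀ q ∈ ofTM2Support M S, ∀ kg, ofTM2 M q = some kg →
      ∀ o, (kg.2 o).1 ∈ ofTM2Support M S := by
  rintro ⟨q, v⟩ hq kg hkg o
  have hmem {q' : Stmt (fun _ : K => Γ) Λ σ} {w : σ}
      (h : (some q', w) ∈ ofTM2Support M S) : some q' ∈ stmts M S :=
    (Finset.mem_product.1 h).1
  have hsub {q₁ q₂ : Stmt (fun _ : K => Γ) Λ σ} {w : σ} (h : q₁ ∈ stmts₁ q₂)
      (h₂ : some q₂ ∈ stmts M S) : (some q₁, w) ∈ ofTM2Support M S :=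
    Finset.mem_product.2 ⟨stmts_trans h h₂, Finset.mem_univ _⟩
  cases q with
  | none => cases hkg
  | some q =>
    have hq' := hmem hq
    cases q <;> cases hkg
    case some.goto.refl f => exact mem_ofTM2Support_of_mem (stmts_supportsStmt hS hq' v) _
    case some.halt.refl =>
      exact Finset.mem_product.2 ⟨by simp [stmts], Finset.mem_univ _⟩
    case some.branch.refl f q₁ q₂ =>
      refine hsub ?_ hq'
      cases f v <;> simp [stmts₁, stmts₁_self]
    all_goals exact hsub (by simp [stmts₁, stmts₁_self]) hq'

end TM2

section Binary

theorem primrec_of_binary_rec {σ : Type*} [Primcodable σ] {u₀ u₁ : List σ} {g : ℕ → List σ}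
    (h₀ : g 0 = []) (h : ∀ n, n ≠ 0 → g n = (if n % 2 = 1 then u₁ else u₀) ++ g (n / 2)) :
    Primrec g := by
  have hrec : Primrec₂ fun (_ : Unit) n => g n := by
    refine Primrec.nat_strong_rec _ (g := fun _ l =>
      if l.length = 0 then some [] else
        (l[l.length / 2]?).map ((if l.length % 2 = 1 then u₁ else u₀) ++ ·)) ?_ ?_
    · have hlen : Primrec fun p : Unit × List (List σ) => p.2.length :=
        Primrec.list_length.comp Primrec.snd
      refine Primrec.ite (Primrec.eq.comp hlen (Primrec.const 0)) (Primrec.const _) ?_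
      refine Primrec.option_map (Primrec.list_getElem?.comp Primrec.snd
        (Primrec.nat_div.comp hlen (Primrec.const 2))) ?_
      refine Primrec.list_append.comp ?_ Primrec.snd
      exact Primrec.ite (Primrec.eq.comp (Primrec.nat_mod.comp (hlen.comp Primrec.fst)
        (Primrec.const 2)) (Primrec.const 1)) (Primrec.const _) (Primrec.const _)
    · intro _ n
      by_cases hn : n = 0
      · simp [hn, h₀]
      · have hlt : n / 2 < n := by omega
        simp [hn, hlt, ← h n hn]
  exact hrec.comp (Primrec.const ()) Primrec.id

open Turing.PartrecToTM2

theorem trNat_eq_cons {n : ℕ} (hn : n ≠ 0) :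
    trNat n = (if n % 2 = 1 then Γ'.bit1 else Γ'.bit0) :: trNat (n / 2) := by
  obtain ⟨b, m, rfl⟩ : ∃ b m, n = Nat.bit b m := ⟨n.bodd, n.div2, (Nat.bit_bodd_div2 n).symm⟩
  rw [trNat, trNat, ← Num.ofNat'_eq, Num.ofNat'_bit, ← Num.ofNat'_eq]
  rw [show Nat.bit b m / 2 = m by
    cases b <;> (simp [Nat.bit]; try omega)]
  have hm : Num.ofNat' m = 0 → m = 0 := fun h => by
    rw [Num.ofNat'_eq] at h
    exact_mod_cast h
  cases h : Num.ofNat' m with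
  | zero =>
    obtain rfl := hm h
    cases b
    · exact absurd rfl hn
    · rfl
  | pos p =>
    cases b
    · simp [Num.bit0, trNum, trPosNum]
    · simp [Num.bit1, trNum, trPosNum]

end Binary

section Reduction

open Turing Turing.PartrecToTM2 StateTransition

instance : Finite K' :=
  Finite.of_surjective (fun i : Fin 4 => ![K'.main, K'.rev, K'.aux, K'.stack] i) fun k => by
    cases k
    exacts [⟨0, rfl⟩, ⟨1, rfl⟩, ⟨2, rfl⟩, ⟨3, rfl⟩]

/-- The part of the initial word that holds the stacks, with `s` on the main stack. -/
def inputWord (s : List Γ') : List (StackLetter K' Γ') :=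
  s.map (fun a => some (.main, some a)) ++
    [some (.main, none), some (.rev, none), some (.aux, none), some (.stack, none)]

theorem represents_inputWord {Q : Type*} (q : Q) (s : List Γ') :
    Represents (q, K'.elim s [] [] []) 0 (.inl q :: (inputWord s).map .inr) := by
  refine ⟨_, rfl, fun k => ?_, ?_⟩
  · cases k <;> simp [stackPart, inputWord, stackWord, List.filter_map, Function.comp_def]
  · simp [tallyPart, inputWord]

/-- Every partial recursive function has a fixed set of rewrite rules over `{a, b}` and a computable
choice of initial strings for which finiteness of the reachable set is its domain. -/
theorem exists_rules_of_partrec {f : ℕ →. ℕ} (hf : Partrec f) :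
    ∃ (R : List (List Bool × List Bool)) (s : ℕ → List Bool), Computable s ∧
      ∀ n, {x | ReflTransGen (MWStep R) (s n) x}.Finite ↔ (f n).Dom := by
  classical
  obtain ⟨c, hc⟩ := ToPartrec.Code.exists_code (Nat.Partrec'.part_iff₁.2 hf)
  let _ : Inhabited Λ' := ⟨trNormal c Cont'.halt⟩
  have hsupp : TM2.Supports tr (codeSupp c Cont'.halt) := tr_supports c Cont'.halt
  let S := ofTM2Support tr (codeSupp c Cont'.halt)
  let δ := (ofTM2 tr).restrict S
  let q₀ : S := ⟨(some (tr (trNormal c Cont'.halt)), none), mem_ofTM2Support_of_mem hsupp.1 none⟩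
  obtain ⟨φ, hφ⟩ := Countable.exists_injective_nat (S ⊕ StackLetter K' Γ')
  have hfin := δ.finite_rules.image fun p => (wordBits φ p.1, wordBits φ p.2)
  refine ⟨hfin.toFinset.toList,
    fun n => wordBits φ (.inl q₀ :: (inputWord (trList [n])).map .inr), ?_, fun n => ?_⟩
  · let bits : List Γ' → List Bool := fun s =>
      wordBits φ (s.map fun a => .inr (some (K'.main, some a)))
    have hbits : Primrec fun n => bits (trNat n) := by
      refine primrec_of_binary_rec (u₀ := bits [Γ'.bit0]) (u₁ := bits [Γ'.bit1]) (by simp [bits])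
        fun n hn => ?_
      rw [trNat_eq_cons hn]
      split_ifs <;> simp [bits]
    refine Primrec.to_comp ((Primrec.list_append.comp (Primrec.list_append.comp
      (Primrec.const (wordBits φ [.inl q₀])) hbits) (Primrec.const (wordBits φ
        ((inputWord [Γ'.cons]).map .inr)))).of_eq fun n => ?_)
    simp [bits, inputWord, trList, Function.comp_def]
  · rw [finite_reachable_wordBits_iff hφ δ.rules_ne_nil (by simp),
      finite_reachable_rules_iff δ (represents_inputWord q₀ _),
      StackMachine.eval_restrict_dom (ofTM2Support_closed hsupp)]
    refine (eval_ofTM2_dom tr (init c [n])).trans ?_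
    rw [PartrecToTM2.tr_eval]
    have := hc (n ::ᵥ List.Vector.nil)
    change c.eval [n] = _ at this
    rw [this]
    exact Iff.rfl

end Reduction

end Multiway

/-- the finiteness problem for multiway systems over a two-element alphabet
is undecidable: no computable predicate decides, given (the encoding of) a multiway
system, whether its growth function is eventually zero. -/
theorem multiway_finiteness_undecidable :
    ¬ ComputablePred (fun p : List (List Bool × List Bool) × List Bool =>
      ∃ N : ℕ, ∀ n : ℕ, N ≤ n → mwGrowth p n = 0) := by
  intro hdec
  have hf : Partrec fun m : ℕ => (Denumerable.ofNat Nat.Partrec.Code m).eval 0 :=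
    Nat.Partrec.Code.eval_part.comp (Computable.ofNat _) (Computable.const 0)
  obtain ⟨R, s, hs, hR⟩ := Multiway.exists_rules_of_partrec hf
  refine ComputablePred.halting_problem 0 (ComputablePred.computable_of_manyOneReducible
    ⟨fun c => (R, s (Encodable.encode c)),
      (Computable.const R).pair (hs.comp Computable.encode), fun c => ?_⟩ hdec)
  rw [Multiway.exists_mwGrowth_eq_zero_iff, hR, Denumerable.ofNat_encode]
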